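/- arXiv:2104.04561 — 3 statements merged into one kernel-verified Lean document; each statement's English description precedes it below -/
import Mathlib

section
/- Let μ be a centered nondegenerate Gaussian measure on ℝⁿ with covariance Q = diag(λ₁,...,λₙ), C a symmetric positive semidefinite n×n matrix, and N₀φ = tr[C D²φ] - ⟨x, Q⁻¹ C Dφ⟩ for φ ∈ C_b^∞(ℝⁿ). Then ∫ (‖Q^{-1/2} C Dφ‖² + tr[(C D²φ)²]) dμ = ∫ (N₀φ)² dμ. -/
open MeasureTheory ProbabilityTheory

/-- `f ∈ C_b^∞`: smooth with all iterated derivatives bounded. -/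
def IsCbSmooth {E F : Type*} [NormedAddCommGroup E] [NormedSpace ℝ E]
    [NormedAddCommGroup F] [NormedSpace ℝ F] (f : E → F) : Prop :=
  ContDiff ℝ (⊤ : ℕ∞) f ∧ ∀ k : ℕ, ∃ C : ℝ, ∀ x : E, ‖iteratedFDeriv ℝ k f x‖ ≤ C

/-- Gradient `Dφ` of `φ : ℝⁿ → ℝ`. -/
noncomputable def gradVec {n : ℕ} (φ : (Fin n → ℝ) → ℝ) (x : Fin n → ℝ) : Fin n → ℝ :=
  fun i => fderiv ℝ φ x (Pi.single i 1)

/-- Hessian `D²φ` of `φ : ℝⁿ → ℝ` as a matrix. -/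
noncomputable def hessMat {n : ℕ} (φ : (Fin n → ℝ) → ℝ) (x : Fin n → ℝ) :
    Matrix (Fin n) (Fin n) ℝ :=
  fun i j => fderiv ℝ (fun y => fderiv ℝ φ y (Pi.single j 1)) x (Pi.single i 1)

/-- The Ornstein–Uhlenbeck type operator `N₀φ = tr[C D²φ] - ⟨x, Q⁻¹ C Dφ⟩` with
diffusion matrix `C` and covariance `Q = diag(lam)`. -/
noncomputable def OUop {n : ℕ} (C : Matrix (Fin n) (Fin n) ℝ) (lam : Fin n → ℝ)
    (φ : (Fin n → ℝ) → ℝ) (x : Fin n → ℝ) : ℝ :=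
  (∑ i, ∑ j, C i j * hessMat φ x j i)
    - ∑ i, x i * (1 / lam i) * (C.mulVec (gradVec φ x)) i

/-- Partial derivative in direction `e_i`. -/
noncomputable def pd {n : ℕ} (i : Fin n) (f : (Fin n → ℝ) → ℝ) (x : Fin n → ℝ) : ℝ :=
  fderiv ℝ f x (Pi.single i 1)

lemma IsCbSmooth.pd {n : ℕ} {f : (Fin n → ℝ) → ℝ} (hf : IsCbSmooth f) (i : Fin n) :
    IsCbSmooth (pd i f) := by
  obtain ⟨h1, h2⟩ := hf
  have h3 : ContDiff ℝ (⊤ : ℕ∞) (fderiv ℝ f) := h1.fderiv_right (by simp)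
  refine ⟨h3.clm_apply contDiff_const, fun k => ?_⟩
  obtain ⟨K, hK⟩ := h2 (k + 1)
  let L : ((Fin n → ℝ) →L[ℝ] ℝ) →L[ℝ] ℝ :=
    ContinuousLinearMap.apply ℝ ℝ (Pi.single i (1 : ℝ) : Fin n → ℝ)
  refine ⟨‖L‖ * K, fun x => ?_⟩
  have h4 := L.norm_iteratedFDeriv_comp_left (n := k) (f := fderiv ℝ f) (x := x)
    h3.contDiffAt (by exact_mod_cast le_top)
  have h5 : (L ∘ fderiv ℝ f) = _root_.pd i f := rfl
  rw [h5, norm_iteratedFDeriv_fderiv] at h4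
  exact h4.trans (mul_le_mul_of_nonneg_left (hK x) (norm_nonneg _))

/-- Membership in every `L^p`, `p` a natural number. -/
def AllLp {α : Type*} [MeasurableSpace α] (μ : Measure α) (f : α → ℝ) : Prop :=
  ∀ p : ℕ, MemLp f p μ

section AllLpSec
variable {α : Type*} [MeasurableSpace α] {μ : Measure α} {f g : α → ℝ}

lemma AllLp.mul (hf : AllLp μ f) (hg : AllLp μ g) : AllLp μ (fun x => f x * g x) := by
  intro p
  have : ENNReal.HolderTriple ((2 * p : ℕ) : ENNReal) ((2 * p : ℕ) : ENNReal) (p : ENNReal) := by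
    constructor
    rcases Nat.eq_zero_or_pos p with h | h
    · subst h; simp
    · push_cast
      rw [ENNReal.mul_inv (by simp) (by simp), ← add_mul, ENNReal.inv_two_add_inv_two, one_mul]
  exact MemLp.mul' (hg (2 * p)) (hf (2 * p))

lemma AllLp.add (hf : AllLp μ f) (hg : AllLp μ g) : AllLp μ (fun x => f x + g x) :=
  fun p => (hf p).add (hg p)

lemma AllLp.sub (hf : AllLp μ f) (hg : AllLp μ g) : AllLp μ (fun x => f x - g x) :=
  fun p => (hf p).sub (hg p)

lemma AllLp.const [IsFiniteMeasure μ] (c : ℝ) : AllLp μ (fun _ => c) :=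
  fun _ => memLp_const c

lemma AllLp.integrable (hf : AllLp μ f) : Integrable f μ := by
  have := hf 1
  rw [Nat.cast_one, memLp_one_iff_integrable] at this
  exact this

end AllLpSec

lemma IsCbSmooth.allLp {n : ℕ} {f : (Fin n → ℝ) → ℝ} (hf : IsCbSmooth f)
    (μ : Measure (Fin n → ℝ)) [IsFiniteMeasure μ] : AllLp μ f := by
  intro p
  obtain ⟨K, hK⟩ := hf.2 0
  refine MemLp.of_bound hf.1.continuous.aestronglyMeasurable K (ae_of_all _ fun x => ?_)
  simpa using hK x

lemma coord_allLp {n : ℕ} (lam : Fin n → NNReal) (i : Fin n) :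
    AllLp (Measure.pi fun j => gaussianReal 0 (lam j)) (fun x => x i) := by
  intro p
  have h := memLp_id_gaussianReal (μ := 0) (v := lam i) p
  exact h.comp_measurePreserving
    (measurePreserving_eval (fun j => gaussianReal 0 (lam j)) i)

lemma hasDerivAt_gaussianPDFReal (v : NNReal) (x : ℝ) :
    HasDerivAt (gaussianPDFReal 0 v) (-(x / v) * gaussianPDFReal 0 v x) x := by
  rw [gaussianPDFReal_def]
  have h1 : HasDerivAt (fun x : ℝ => -(x - 0) ^ 2 / (2 * (v : ℝ))) (-(x / v)) x := by
    have := ((((hasDerivAt_id x).sub_const 0).pow 2).neg).div_const (2 * (v : ℝ))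
    refine this.congr_deriv ?_
    by_cases hv : (v : ℝ) = 0
    · simp [hv]
    · simp; field_simp
  refine (h1.exp.const_mul _).congr_deriv ?_
  ring

lemma gaussian_integrable_iff {v : NNReal} (hv : v ≠ 0) {f : ℝ → ℝ} :
    Integrable f (gaussianReal 0 v) ↔ Integrable (fun x => gaussianPDFReal 0 v x * f x) := by
  rw [gaussianReal_of_var_ne_zero _ hv,
    integrable_withDensity_iff_integrable_smul' (measurable_gaussianPDF _ _)
      (ae_of_all _ fun _ => gaussianPDF_lt_top)]
  simp [toReal_gaussianPDF]

lemma ibp_one {v : NNReal} (hv : v ≠ 0) {f f' : ℝ → ℝ} (hd : ∀ x, HasDerivAt f (f' x) x)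
    (hf : Integrable f (gaussianReal 0 v)) (hf' : Integrable f' (gaussianReal 0 v))
    (hxf : Integrable (fun x => x / v * f x) (gaussianReal 0 v)) :
    ∫ x, f' x ∂(gaussianReal 0 v) = ∫ x, x / v * f x ∂(gaussianReal 0 v) := by
  rw [← sub_eq_zero, ← integral_sub hf' hxf, integral_gaussianReal_eq_integral_smul hv]
  have h0 := (gaussian_integrable_iff hv).1 (hf'.sub hxf)
  refine integral_eq_zero_of_hasDerivAt_of_integrable
    (f := fun x => gaussianPDFReal 0 v x * f x) (fun x => ?_) h0 ((gaussian_integrable_iff hv).1 hf)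
  refine ((hasDerivAt_gaussianPDFReal v x).mul (hd x)).congr_deriv ?_
  simp only [smul_eq_mul]; ring

lemma ibp {n : ℕ} (lam : Fin n → NNReal) (hlam : ∀ i, 0 < lam i) (i : Fin n)
    {f f' : (Fin n → ℝ) → ℝ}
    (hd : ∀ x, HasLineDerivAt ℝ f (f' x) x (Pi.single i 1))
    (hf : AllLp (Measure.pi fun j => gaussianReal 0 (lam j)) f)
    (hf' : AllLp (Measure.pi fun j => gaussianReal 0 (lam j)) f') :
    ∫ x, f' x ∂(Measure.pi fun j => gaussianReal 0 (lam j))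
      = ∫ x, x i / lam i * f x ∂(Measure.pi fun j => gaussianReal 0 (lam j)) := by
  have hxf : AllLp (Measure.pi fun j => gaussianReal 0 (lam j)) (fun x => x i / lam i * f x) := by
    simp only [div_eq_mul_inv]
    exact ((coord_allLp lam i).mul (AllLp.const _)).mul hf
  cases n with
  | zero => exact i.elim0
  | succ n =>
    have hm := (measurePreserving_piFinSuccAbove (fun j => gaussianReal 0 (lam j)) i).symm
    set e := (MeasurableEquiv.piFinSuccAbove (fun _ : Fin (n + 1) => ℝ) i).symm with he
    have hint : ∀ {g : (Fin (n + 1) → ℝ) → ℝ},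
        AllLp (Measure.pi fun j => gaussianReal 0 (lam j)) g →
        Integrable (fun z => g (e z)) ((gaussianReal 0 (lam i)).prod
          (Measure.pi fun j => gaussianReal 0 (lam (i.succAbove j)))) := fun hg =>
      (hm.integrable_comp_emb e.measurableEmbedding).2 hg.integrable
    rw [← hm.integral_comp e.measurableEmbedding, ← hm.integral_comp e.measurableEmbedding,
      integral_prod_symm _ (hint hf'), integral_prod_symm _ (hint hxf)]
    refine integral_congr_ae ?_
    filter_upwards [(hint hf).prod_left_ae, (hint hf').prod_left_ae, (hint hxf).prod_left_ae]
      with y h1 h2 h3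
    have hins : ∀ t : ℝ, e (t, y) = i.insertNth (α := fun _ => ℝ) t y := fun t => rfl
    have key : ∀ t, e (t, y) i = t := fun t => by
      rw [hins, Fin.insertNth_apply_same]
    simp only [key] at h3 ⊢
    refine ibp_one (hlam i).ne' (fun t => ?_) h1 h2 h3
    have h4 := hd (e (t, y))
    unfold HasLineDerivAt at h4
    have h5 : ∀ s : ℝ, e (t, y) + (s - t) • (Pi.single i 1 : Fin (n + 1) → ℝ) = e (s, y) := by
      intro s
      ext j
      refine Fin.succAboveCases i ?_ (fun j => ?_) j
      · simp [key]
      · simp [hins]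
    have h6 : HasDerivAt (fun s : ℝ => s - t) 1 t := (hasDerivAt_id t).sub_const t
    have h7 := HasDerivAt.scomp_of_eq t h4 h6 (by simp)
    simp only [Function.comp_def, h5, one_smul] at h7
    exact h7

lemma IsCbSmooth.hasLine {n : ℕ} {f : (Fin n → ℝ) → ℝ} (hf : IsCbSmooth f) (i : Fin n)
    (x : Fin n → ℝ) : HasLineDerivAt ℝ f (_root_.pd i f x) x (Pi.single i 1) :=
  ((hf.1.differentiable (by simp)) x).hasFDerivAt.hasLineDerivAt _

lemma coord_hasLine {n : ℕ} (i k : Fin n) (x : Fin n → ℝ) :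
    HasLineDerivAt ℝ (fun x : Fin n → ℝ => x k) (if i = k then 1 else 0) x (Pi.single i 1) := by
  have h := (ContinuousLinearMap.proj (R := ℝ) (φ := fun _ : Fin n => ℝ) k).hasFDerivAt (x := x)
  have h2 := h.hasLineDerivAt (Pi.single i 1)
  simp only [ContinuousLinearMap.proj_apply, Pi.single_apply] at h2
  simp only [eq_comm (a := i)]
  exact h2

lemma pd_comm {n : ℕ} {f : (Fin n → ℝ) → ℝ} (hf : IsCbSmooth f) (i j : Fin n)
    (x : Fin n → ℝ) : pd i (pd j f) x = pd j (pd i f) x := by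
  have h3 : ContDiff ℝ (⊤ : ℕ∞) (fderiv ℝ f) := hf.1.fderiv_right (by simp)
  have hd : DifferentiableAt ℝ (fderiv ℝ f) x := h3.differentiable (by simp) x
  have h : ∀ v w : Fin n → ℝ,
      fderiv ℝ (fun y => fderiv ℝ f y v) x w = fderiv ℝ (fderiv ℝ f) x w v := by
    intro v w
    rw [fderiv_clm_apply hd (by fun_prop)]
    simp
  have hs : IsSymmSndFDerivAt ℝ f x :=
    hf.1.contDiffAt.isSymmSndFDerivAt (by
      rw [minSmoothness_of_isRCLikeNormedField]
      exact WithTop.coe_le_coe.2 (le_top : (2 : ℕ∞) ≤ ⊤))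
  change fderiv ℝ (fun y => fderiv ℝ f y _) x _ = fderiv ℝ (fun y => fderiv ℝ f y _) x _
  rw [h, h]
  exact hs _ _

lemma hasLine_mul {n : ℕ} {f g : (Fin n → ℝ) → ℝ} {a b : ℝ} {x v : Fin n → ℝ}
    (hf : HasLineDerivAt ℝ f a x v) (hg : HasLineDerivAt ℝ g b x v) :
    HasLineDerivAt ℝ (fun y => f y * g y) (a * g x + f x * b) x v := by
  unfold HasLineDerivAt at *
  exact (hf.mul hg).congr_deriv (by simp)

lemma hasLine_sub {n : ℕ} {f g : (Fin n → ℝ) → ℝ} {a b : ℝ} {x v : Fin n → ℝ}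
    (hf : HasLineDerivAt ℝ f a x v) (hg : HasLineDerivAt ℝ g b x v) :
    HasLineDerivAt ℝ (fun y => f y - g y) (a - b) x v := by
  unfold HasLineDerivAt at *
  exact hf.sub hg

lemma key_identity {n : ℕ} (lam : Fin n → NNReal) (hlam : ∀ i, 0 < lam i)
    {a b : (Fin n → ℝ) → ℝ} (ha : IsCbSmooth a) (hb : IsCbSmooth b) (i k : Fin n) :
    ∫ x, (x i / lam i * a x - pd i a x) * (x k / lam k * b x - pd k b x)
        ∂(Measure.pi fun j => gaussianReal 0 (lam j))
      = ∫ x, ((if i = k then 1 / (lam i : ℝ) else 0) * (a x * b x) + pd k a x * pd i b x)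
        ∂(Measure.pi fun j => gaussianReal 0 (lam j)) := by
  set μ := Measure.pi fun j => gaussianReal 0 (lam j) with hμ
  have cb : ∀ {f : (Fin n → ℝ) → ℝ}, IsCbSmooth f → AllLp μ f := fun hf => hf.allLp μ
  have hx : ∀ j, AllLp μ (fun x => x j / lam j) := fun j => by
    simp only [div_eq_mul_inv]
    exact (coord_allLp lam j).mul (AllLp.const _)
  have hxl : ∀ x : Fin n → ℝ, HasLineDerivAt ℝ (fun x : Fin n → ℝ => x k / (lam k : ℝ))
      (if i = k then 1 / (lam i : ℝ) else 0) x (Pi.single i 1) := by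
    intro x
    have h := coord_hasLine i k x
    unfold HasLineDerivAt at *
    refine (h.div_const (lam k : ℝ)).congr_deriv ?_
    split_ifs with hik
    · rw [hik]
    · simp
  have hg : AllLp μ (fun x => x k / lam k * b x - pd k b x) :=
    ((hx k).mul (cb hb)).sub (cb (hb.pd k))
  have hg' : AllLp μ (fun x => (if i = k then 1 / (lam i : ℝ) else 0) * b x
      + x k / lam k * pd i b x - pd i (pd k b) x) :=
    (((AllLp.const _).mul (cb hb)).add ((hx k).mul (cb (hb.pd i)))).sub (cb ((hb.pd k).pd i))
  have hf1' := ((cb (ha.pd i)).mul hg).add ((cb ha).mul hg')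
  have e1 := ibp lam hlam i
    (fun x => hasLine_mul (ha.hasLine i x)
      (hasLine_sub (hasLine_mul (hxl x) (hb.hasLine i x)) ((hb.pd k).hasLine i x)))
    ((cb ha).mul hg) hf1'
  have hf2' := ((cb (ha.pd k)).mul (cb (hb.pd i))).add ((cb ha).mul (cb ((hb.pd i).pd k)))
  have e2 := ibp lam hlam k
    (fun x => hasLine_mul (ha.hasLine k x) ((hb.pd i).hasLine k x))
    ((cb ha).mul (cb (hb.pd i))) hf2'
  have i1 := ((hx i).mul ((cb ha).mul hg)).integrable
  have i2 := ((hx k).mul ((cb ha).mul (cb (hb.pd i)))).integrable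
  have hL := (((hx i).mul (cb ha)).sub (cb (ha.pd i))).mul hg
  have hR := ((AllLp.const (μ := μ) (if i = k then 1 / (lam i : ℝ) else 0)).mul
    ((cb ha).mul (cb hb))).add ((cb (ha.pd k)).mul (cb (hb.pd i)))
  rw [← sub_eq_zero] at e1 e2 ⊢
  rw [← integral_sub hf1'.integrable i1] at e1
  rw [← integral_sub hf2'.integrable i2] at e2
  rw [← integral_sub hL.integrable hR.integrable]
  have e3 := congrArg₂ (fun s t : ℝ => -(s + t)) e1 e2
  rw [← integral_add (by exact hf1'.integrable.sub i1) (by exact hf2'.integrable.sub i2),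
    ← integral_neg] at e3
  rw [add_zero, neg_zero] at e3
  refine Eq.trans ?_ e3
  refine integral_congr_ae (ae_of_all _ fun x => ?_)
  beta_reduce
  rw [pd_comm hb k i]
  ring

/-- Second order regularity identity for the Ornstein–Uhlenbeck operator:
`∫ (‖Q^{-1/2} C Dφ‖² + tr[(C D²φ)²]) dμ = ∫ (N₀φ)² dμ` for `φ ∈ C_b^∞(ℝⁿ)`. -/
theorem OU_second_order_regularity_identity
    {n : ℕ} (lam : Fin n → NNReal) (hlam : ∀ i, 0 < lam i)
    (C : Matrix (Fin n) (Fin n) ℝ) (hCsymm : C.IsSymm) (hC : C.PosSemidef)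
    (φ : (Fin n → ℝ) → ℝ) (hφ : IsCbSmooth φ) :
    ∫ x, ((∑ i, (1 / (lam i : ℝ)) * ((C.mulVec (gradVec φ x)) i) ^ 2)
          + ∑ i, ∑ j, (∑ k, C i k * hessMat φ x k j) * (∑ k, C j k * hessMat φ x k i))
        ∂(Measure.pi fun j => gaussianReal 0 (lam j))
      = ∫ x, (OUop C (fun i => (lam i : ℝ)) φ x) ^ 2
          ∂(Measure.pi fun j => gaussianReal 0 (lam j)) := by
  classical
  set μ := Measure.pi fun j => gaussianReal 0 (lam j) with hμ
  have cb : ∀ {f : (Fin n → ℝ) → ℝ}, IsCbSmooth f → AllLp μ f := fun hf => hf.allLp μ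
  have hx : ∀ j, AllLp μ (fun x => x j / lam j) := fun j => by
    simp only [div_eq_mul_inv]
    exact (coord_allLp lam j).mul (AllLp.const _)
  have hD : ∀ i j, AllLp μ (fun x => x i / lam i * pd j φ x - pd i (pd j φ) x) := fun i j =>
    ((hx i).mul (cb (hφ.pd j))).sub (cb ((hφ.pd j).pd i))
  have hOU : ∀ x, OUop C (fun i => (lam i : ℝ)) φ x
      = - ∑ i, ∑ j, C i j * (x i / lam i * pd j φ x - pd i (pd j φ) x) := by
    intro x
    have hh : ∀ i j, hessMat φ x j i = pd i (pd j φ) x := fun i j => pd_comm hφ j i x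
    simp only [OUop, hh, Matrix.mulVec, dotProduct, Finset.mul_sum]
    rw [← Finset.sum_sub_distrib, ← Finset.sum_neg_distrib]
    refine Finset.sum_congr rfl fun i _ => ?_
    rw [← Finset.sum_sub_distrib, ← Finset.sum_neg_distrib]
    refine Finset.sum_congr rfl fun j _ => ?_
    change _ - x i * (1 / (lam i : ℝ)) * (C i j * pd j φ x) = _
    ring
  have hR : ∀ x, (OUop C (fun i => (lam i : ℝ)) φ x) ^ 2
      = ∑ i, ∑ j, ∑ k, ∑ l, C i j * C k l *
        ((x i / lam i * pd j φ x - pd i (pd j φ) x)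
          * (x k / lam k * pd l φ x - pd k (pd l φ) x)) := by
    intro x
    rw [hOU, neg_sq, sq, Finset.sum_mul]
    simp only [Finset.sum_mul]
    refine Finset.sum_congr rfl fun i _ => Finset.sum_congr rfl fun j _ => ?_
    simp only [Finset.mul_sum]
    refine Finset.sum_congr rfl fun k _ => Finset.sum_congr rfl fun l _ => ?_
    ring
  have hL : ∀ x, ((∑ i, (1 / (lam i : ℝ)) * ((C.mulVec (gradVec φ x)) i) ^ 2)
          + ∑ i, ∑ j, (∑ k, C i k * hessMat φ x k j) * (∑ k, C j k * hessMat φ x k i))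
      = ∑ i, ∑ j, ∑ k, ∑ l, C i j * C k l *
        ((if i = k then 1 / (lam i : ℝ) else 0) * (pd j φ x * pd l φ x)
          + pd k (pd j φ) x * pd i (pd l φ) x) := by
    intro x
    have hh : ∀ i j, hessMat φ x j i = pd i (pd j φ) x := fun i j => pd_comm hφ j i x
    have hg : ∀ j, gradVec φ x j = pd j φ x := fun j => rfl
    simp only [hh, Matrix.mulVec, dotProduct, hg]
    rw [← Finset.sum_add_distrib]
    refine Finset.sum_congr rfl fun i _ => ?_
    simp only [mul_add, Finset.sum_add_distrib]
    congr 1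
    · rw [sq, Finset.sum_mul_sum, Finset.mul_sum]
      refine Finset.sum_congr rfl fun j _ => ?_
      symm
      rw [Finset.sum_eq_single i]
      · rw [Finset.mul_sum]
        refine Finset.sum_congr rfl fun l _ => ?_
        simp; ring
      · intro k _ hk
        simp [Ne.symm hk]
      · simp
    · rw [Finset.sum_comm]
      refine Finset.sum_congr rfl fun k _ => ?_
      rw [Finset.sum_mul_sum]
      refine Finset.sum_congr rfl fun j _ => Finset.sum_congr rfl fun l _ => ?_
      ring
  have hI1 : ∀ i j k l, Integrable (fun x => C i j * C k l *
        ((x i / lam i * pd j φ x - pd i (pd j φ) x)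
          * (x k / lam k * pd l φ x - pd k (pd l φ) x))) μ := fun i j k l =>
    ((hD i j).mul (hD k l)).integrable.const_mul _
  have hI2 : ∀ i j k l, Integrable (fun x => C i j * C k l *
        ((if i = k then 1 / (lam i : ℝ) else 0) * (pd j φ x * pd l φ x)
          + pd k (pd j φ) x * pd i (pd l φ) x)) μ := fun i j k l =>
    (((AllLp.const (μ := μ) _).mul ((cb (hφ.pd j)).mul (cb (hφ.pd l)))).add
      ((cb ((hφ.pd j).pd k)).mul (cb ((hφ.pd l).pd i)))).integrable.const_mul _
  simp only [hR, hL]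
  have push : ∀ F : Fin n → Fin n → Fin n → Fin n → (Fin n → ℝ) → ℝ,
      (∀ i j k l, Integrable (F i j k l) μ) →
      ∫ x, ∑ i, ∑ j, ∑ k, ∑ l, F i j k l x ∂μ = ∑ i, ∑ j, ∑ k, ∑ l, ∫ x, F i j k l x ∂μ := by
    intro F hF
    rw [integral_finsetSum _ fun i _ => integrable_finsetSum _ fun j _ =>
      integrable_finsetSum _ fun k _ => integrable_finsetSum _ fun l _ => hF i j k l]
    refine Finset.sum_congr rfl fun i _ => ?_
    rw [integral_finsetSum _ fun j _ =>
      integrable_finsetSum _ fun k _ => integrable_finsetSum _ fun l _ => hF i j k l]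
    refine Finset.sum_congr rfl fun j _ => ?_
    rw [integral_finsetSum _ fun k _ => integrable_finsetSum _ fun l _ => hF i j k l]
    refine Finset.sum_congr rfl fun k _ => ?_
    rw [integral_finsetSum _ fun l _ => hF i j k l]
  rw [push _ hI1, push _ hI2]
  refine Finset.sum_congr rfl fun i _ => Finset.sum_congr rfl fun j _ =>
    Finset.sum_congr rfl fun k _ => Finset.sum_congr rfl fun l _ => ?_
  rw [integral_const_mul, integral_const_mul, key_identity lam hlam (hφ.pd j) (hφ.pd l) i k]
end

section
/- Let μ be a centered nondegenerate Gaussian measure on ℝⁿ with covariance Q whose largest eigenvalue is λ₁, and let C be a symmetric positive semidefinite matrix commuting with Q (diagonal in the same basis). For φ ∈ C_b^∞(ℝⁿ) with N₀φ = tr[CD²φ] - ⟨x, Q⁻¹CDφ⟩, one has (1/λ₁)∫ ‖C Dφ‖² dμ + ∫ tr[(CD²φ)²] dμ ≤ ∫ (N₀φ)² dμ. -/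
open MeasureTheory ProbabilityTheory

open scoped ENNReal

/-- The product Gaussian density. -/
noncomputable def ouDens {n : ℕ} (lam : Fin n → NNReal) (x : Fin n → ℝ) : ℝ :=
  ∏ i, gaussianPDFReal 0 (lam i) (x i)

lemma ouDens_nonneg {n : ℕ} (lam : Fin n → NNReal) (x : Fin n → ℝ) : 0 ≤ ouDens lam x :=
  Finset.prod_nonneg fun i _ => gaussianPDFReal_nonneg _ _ _

lemma ouDens_measurable {n : ℕ} (lam : Fin n → NNReal) : Measurable (ouDens lam) := by
  unfold ouDens
  refine Finset.measurable_prod _ fun i _ => ?_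
  exact (measurable_gaussianPDFReal 0 (lam i)).comp (measurable_pi_apply i)

lemma pi_gauss_eq {n : ℕ} (lam : Fin n → NNReal) (hlam : ∀ i, 0 < lam i) :
    (Measure.pi fun j => gaussianReal 0 (lam j))
      = volume.withDensity (fun x => ENNReal.ofReal (ouDens lam x)) := by
  refine Measure.pi_eq fun s hs => ?_
  rw [withDensity_apply _ (MeasurableSet.univ_pi hs), volume_pi, Measure.restrict_pi_pi,
    ← ofReal_integral_eq_lintegral_ofReal]
  · unfold ouDens
    rw [integral_fintype_prod_eq_prod (fun i => gaussianPDFReal 0 (lam i)),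
      ENNReal.ofReal_prod_of_nonneg]
    · exact Finset.prod_congr rfl fun i _ =>
        (gaussianReal_apply_eq_integral 0 (hlam i).ne' (s i)).symm
    · exact fun i _ => integral_nonneg fun x => gaussianPDFReal_nonneg _ _ _
  · unfold ouDens
    exact Integrable.fintype_prod (f := fun i => gaussianPDFReal 0 (lam i))
      fun i => (integrable_gaussianPDFReal 0 (lam i)).restrict
  · exact Filter.Eventually.of_forall fun x => ouDens_nonneg lam x

lemma ouDens_eq_exp {n : ℕ} (lam : Fin n → NNReal) (x : Fin n → ℝ) :
    ouDens lam x = (∏ i, (√(2 * Real.pi * lam i))⁻¹) *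
      Real.exp (∑ i, -(x i) ^ 2 / (2 * lam i)) := by
  simp [ouDens, gaussianPDFReal, Finset.prod_mul_distrib, Real.exp_sum]

lemma ouDens_hasFDerivAt {n : ℕ} (lam : Fin n → NNReal) (hlam : ∀ i, 0 < lam i)
    (x : Fin n → ℝ) : DifferentiableAt ℝ (ouDens lam) x ∧ ∀ i : Fin n,
    fderiv ℝ (ouDens lam) x (Pi.single i 1) = - (x i / lam i) * ouDens lam x := by
  have h1 : HasFDerivAt (fun y : Fin n → ℝ => ∑ i, -(y i) ^ 2 / (2 * (lam i : ℝ)))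
      (∑ i, (-(x i) / lam i) • ContinuousLinearMap.proj (R := ℝ) (φ := fun _ : Fin n => ℝ) i) x := by
    refine HasFDerivAt.fun_sum fun i _ => ?_
    have h0 : HasDerivAt (fun t : ℝ => -t ^ 2 / (2 * (lam i : ℝ))) (-(x i) / lam i) (x i) := by
      have h := (((hasDerivAt_id (x i)).pow 2).neg).div_const (2 * (lam i : ℝ))
      have : (lam i : ℝ) ≠ 0 := by exact_mod_cast (hlam i).ne'
      refine HasDerivAt.congr_deriv h ?_
      simp only [id_eq]
      field_simp
      norm_num
    exact h0.comp_hasFDerivAt x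
      (ContinuousLinearMap.proj (R := ℝ) (φ := fun _ : Fin n => ℝ) i).hasFDerivAt
  have h2 := h1.exp.const_mul (∏ i, (√(2 * Real.pi * lam i))⁻¹)
  rw [← show ouDens lam = _ from funext (ouDens_eq_exp lam)] at h2
  refine ⟨h2.differentiableAt, fun i => ?_⟩
  rw [h2.fderiv, ouDens_eq_exp]
  simp [Pi.single_apply]
  ring

/-- All moments finite. -/
def OUGood {n : ℕ} (lam : Fin n → NNReal) (f : (Fin n → ℝ) → ℝ) : Prop :=
  ∀ p : ℝ≥0∞, p ≠ ∞ → MemLp f p (Measure.pi fun j => gaussianReal 0 (lam j))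

namespace OUGood
variable {n : ℕ} {lam : Fin n → NNReal} {f g : (Fin n → ℝ) → ℝ}

lemma mul (hf : OUGood lam f) (hg : OUGood lam g) : OUGood lam (fun x => f x * g x) := by
  intro p hp
  have : ENNReal.HolderTriple (p * 2) (p * 2) p := ⟨by
    rw [ENNReal.mul_inv (by simp) (by simp), ← mul_add, ENNReal.inv_two_add_inv_two, mul_one]⟩
  have h2 : p * 2 ≠ ∞ := ENNReal.mul_ne_top hp (by simp)
  exact MemLp.mul' (hg _ h2) (hf _ h2)

lemma add (hf : OUGood lam f) (hg : OUGood lam g) : OUGood lam (fun x => f x + g x) :=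
  fun p hp => (hf p hp).add (hg p hp)

lemma sub (hf : OUGood lam f) (hg : OUGood lam g) : OUGood lam (fun x => f x - g x) :=
  fun p hp => (hf p hp).sub (hg p hp)

lemma const_mul (hf : OUGood lam f) (a : ℝ) : OUGood lam (fun x => a * f x) :=
  fun p hp => (hf p hp).const_mul a

lemma div_const (hf : OUGood lam f) (a : ℝ) : OUGood lam (fun x => f x / a) := by
  simpa [div_eq_inv_mul] using hf.const_mul a⁻¹

lemma coord (lam : Fin n → NNReal) (i : Fin n) : OUGood lam (fun x => x i) := fun p hp =>
  (memLp_id_gaussianReal' (μ := 0) (v := lam i) p hp).comp_measurePreserving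
    (measurePreserving_eval (fun j => gaussianReal 0 (lam j)) i)

lemma integrable (hf : OUGood lam f) :
    Integrable f (Measure.pi fun j => gaussianReal 0 (lam j)) :=
  memLp_one_iff_integrable.1 (hf 1 (by simp))

end OUGood

lemma IsCbSmooth.good {n : ℕ} (lam : Fin n → NNReal) {f : (Fin n → ℝ) → ℝ}
    (hf : IsCbSmooth f) : OUGood lam f := by
  intro p hp
  obtain ⟨C, hC⟩ := hf.2 0
  exact MemLp.of_bound hf.1.continuous.aestronglyMeasurable C
    (Filter.Eventually.of_forall fun x => by simpa using hC x)

lemma IsCbSmooth.diff {n : ℕ} {f : (Fin n → ℝ) → ℝ} (hf : IsCbSmooth f) : Differentiable ℝ f :=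
  hf.1.differentiable (by simp)

lemma IsCbSmooth.pderiv {n : ℕ} {f : (Fin n → ℝ) → ℝ} (hf : IsCbSmooth f) (v : Fin n → ℝ) :
    IsCbSmooth (fun x => fderiv ℝ f x v) := by
  have h1 : ContDiff ℝ (⊤ : ℕ∞) (fderiv ℝ f) := hf.1.fderiv_right (by simp)
  refine ⟨h1.clm_apply contDiff_const, fun k => ?_⟩
  obtain ⟨C, hC⟩ := hf.2 (k + 1)
  refine ⟨‖v‖ * C, fun x => ?_⟩
  refine (norm_iteratedFDeriv_clm_apply_const (N := (⊤ : ℕ∞)) h1.contDiffAt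
    (by exact_mod_cast le_top)).trans ?_
  rw [norm_iteratedFDeriv_fderiv]
  exact mul_le_mul_of_nonneg_left (hC x) (norm_nonneg _)

/-- Gaussian integration by parts. -/
lemma ou_ibp {n : ℕ} (lam : Fin n → NNReal) (hlam : ∀ i, 0 < lam i) (i : Fin n)
    {f : (Fin n → ℝ) → ℝ} (hd : Differentiable ℝ f) (hf : OUGood lam f)
    (hf' : OUGood lam (fun x => fderiv ℝ f x (Pi.single i 1))) :
    ∫ x, x i / lam i * f x ∂(Measure.pi fun j => gaussianReal 0 (lam j))
      = ∫ x, fderiv ℝ f x (Pi.single i 1) ∂(Measure.pi fun j => gaussianReal 0 (lam j)) := by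
  have hm : Measurable (fun x => ENNReal.ofReal (ouDens lam x)) :=
    (ouDens_measurable lam).ennreal_ofReal
  have hlt : ∀ᵐ x ∂(volume : Measure (Fin n → ℝ)), ENNReal.ofReal (ouDens lam x) < ∞ :=
    Filter.Eventually.of_forall fun x => ENNReal.ofReal_lt_top
  have key : ∀ g : (Fin n → ℝ) → ℝ, OUGood lam g → Integrable (fun x => ouDens lam x * g x) := by
    intro g hg
    have h := hg.integrable
    rw [pi_gauss_eq lam hlam, integrable_withDensity_iff_integrable_smul' hm hlt] at h
    simpa [ENNReal.toReal_ofReal (ouDens_nonneg lam _)] using h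
  rw [pi_gauss_eq lam hlam, integral_withDensity_eq_integral_toReal_smul hm hlt,
    integral_withDensity_eq_integral_toReal_smul hm hlt]
  simp only [ENNReal.toReal_ofReal (ouDens_nonneg lam _), smul_eq_mul]
  have hx : OUGood lam (fun x => x i / lam i * f x) := ((OUGood.coord lam i).div_const _).mul hf
  have e : ∀ x, fderiv ℝ (ouDens lam) x (Pi.single i 1) * f x
      = -(ouDens lam x * (x i / lam i * f x)) := fun x => by
    rw [(ouDens_hasFDerivAt lam hlam x).2 i]; ring
  rw [integral_mul_fderiv_eq_neg_fderiv_mul_of_integrable (𝕜 := ℝ) ?_ (key _ hf') (key _ hf)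
    (fun x _ => (ouDens_hasFDerivAt lam hlam x).1) (fun x _ => hd x)]
  · simp only [e, integral_neg, neg_neg]
  · simp only [e]
    exact (key _ hx).neg

lemma ou_symm {n : ℕ} {f : (Fin n → ℝ) → ℝ} (hf : IsCbSmooth f) (v w x : Fin n → ℝ) :
    fderiv ℝ (fun y => fderiv ℝ f y w) x v = fderiv ℝ (fun y => fderiv ℝ f y v) x w := by
  have h1 : ContDiff ℝ (⊤ : ℕ∞) (fderiv ℝ f) := hf.1.fderiv_right (by simp)
  have h2 : DifferentiableAt ℝ (fderiv ℝ f) x := h1.differentiable (by simp) x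
  have hs : IsSymmSndFDerivAt ℝ f x := hf.1.contDiffAt.isSymmSndFDerivAt
    (by simp only [minSmoothness_of_isRCLikeNormedField]; exact WithTop.coe_le_coe.2 (le_top : (2 : ℕ∞) ≤ ⊤))
  have e : ∀ w v, fderiv ℝ (fun y => fderiv ℝ f y w) x v = fderiv ℝ (fderiv ℝ f) x v w := by
    intro w v
    rw [fderiv_clm_apply h2 (differentiableAt_const _)]
    simp
  rw [e, e, hs.eq]

lemma ou_key {n : ℕ} (lam : Fin n → NNReal) (hlam : ∀ i, 0 < lam i) (i j : Fin n)
    {u v : (Fin n → ℝ) → ℝ} (hu : IsCbSmooth u) (hv : IsCbSmooth v) :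
    ∫ x, (x i / lam i * u x - fderiv ℝ u x (Pi.single i 1)) *
        (x j / lam j * v x - fderiv ℝ v x (Pi.single j 1))
          ∂(Measure.pi fun j => gaussianReal 0 (lam j))
      = (∫ x, fderiv ℝ u x (Pi.single j 1) * fderiv ℝ v x (Pi.single i 1)
          ∂(Measure.pi fun j => gaussianReal 0 (lam j)))
        + (if i = j then 1 / (lam i : ℝ) else 0) *
          ∫ x, u x * v x ∂(Measure.pi fun j => gaussianReal 0 (lam j)) := by
  set μ := Measure.pi fun j => gaussianReal 0 (lam j) with hμ
  set a : ℝ := if i = j then 1 / (lam i : ℝ) else 0 with ha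
  have Du := fun k : Fin n => hu.pderiv (Pi.single k 1)
  have Dv := fun k : Fin n => hv.pderiv (Pi.single k 1)
  have DDv := fun k l : Fin n => (Dv k).pderiv (Pi.single l 1)
  have gx := fun k : Fin n => (OUGood.coord lam k).div_const (lam k)
  set w : (Fin n → ℝ) → ℝ := fun x => x j / lam j * v x - fderiv ℝ v x (Pi.single j 1) with hw
  have gw : OUGood lam w := ((gx j).mul (hv.good lam)).sub ((Dv j).good lam)
  have hxd : ∀ x : Fin n → ℝ, HasFDerivAt (fun y : Fin n → ℝ => y j / (lam j : ℝ))
      ((lam j : ℝ)⁻¹ • ContinuousLinearMap.proj (R := ℝ) (φ := fun _ : Fin n => ℝ) j) x := by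
    intro x
    have := (ContinuousLinearMap.proj (R := ℝ) (φ := fun _ : Fin n => ℝ) j).hasFDerivAt
      (x := x) |>.const_mul ((lam j : ℝ)⁻¹)
    simpa [div_eq_inv_mul] using this
  have hwd : ∀ x, HasFDerivAt w _ x := fun x =>
    ((hxd x).mul (hv.diff x).hasFDerivAt).sub ((Dv j).diff x).hasFDerivAt
  have Dw : ∀ x, fderiv ℝ w x (Pi.single i 1) = a * v x
      + x j / lam j * fderiv ℝ v x (Pi.single i 1)
      - fderiv ℝ (fun y => fderiv ℝ v y (Pi.single j 1)) x (Pi.single i 1) := by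
    intro x
    rw [(hwd x).fderiv]
    by_cases hij : i = j
    · subst hij
      simp [ha]
      ring
    · simp [ha, hij, Ne.symm hij]
  have gDw : OUGood lam (fun x => fderiv ℝ w x (Pi.single i 1)) := by
    simp only [Dw]
    exact (((hv.good lam).const_mul a).add ((gx j).mul ((Dv i).good lam))).sub
      ((DDv j i).good lam)
  have D1 : ∀ x, fderiv ℝ (fun y => u y * w y) x (Pi.single i 1)
      = u x * fderiv ℝ w x (Pi.single i 1) + fderiv ℝ u x (Pi.single i 1) * w x := by
    intro x
    rw [fderiv_fun_mul (hu.diff x) (hwd x).differentiableAt]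
    simp [mul_comm]
  have D2 : ∀ x, fderiv ℝ (fun y => u y * fderiv ℝ v y (Pi.single i 1)) x (Pi.single j 1)
      = u x * fderiv ℝ (fun y => fderiv ℝ v y (Pi.single i 1)) x (Pi.single j 1)
        + fderiv ℝ u x (Pi.single j 1) * fderiv ℝ v x (Pi.single i 1) := by
    intro x
    rw [fderiv_fun_mul (hu.diff x) ((Dv i).diff x)]
    simp [mul_comm]
  have gu := hu.good lam
  have g1 := gu.mul gDw
  have g2 := ((Du i).good lam).mul gw
  have g3 := gu.mul ((DDv i j).good lam)
  have g4 := ((Du j).good lam).mul ((Dv i).good lam)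
  have I1 := ou_ibp lam hlam i (f := fun y => u y * w y)
    (fun x => (hu.diff x).mul (hwd x).differentiableAt) (gu.mul gw)
    (by simp only [D1]; exact g1.add g2)
  have I2 := ou_ibp lam hlam j (f := fun y => u y * fderiv ℝ v y (Pi.single i 1))
    (fun x => (hu.diff x).mul ((Dv i).diff x)) (gu.mul ((Dv i).good lam))
    (by simp only [D2]; exact g3.add g4)
  simp only [D1] at I1
  simp only [D2] at I2
  rw [← hμ] at I1 I2
  rw [integral_add g1.integrable g2.integrable] at I1
  rw [integral_add g3.integrable g4.integrable] at I2
  have E1 : ∫ x, (x i / lam i * u x - fderiv ℝ u x (Pi.single i 1)) * w x ∂μ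
      = ∫ x, x i / lam i * (u x * w x) ∂μ - ∫ x, fderiv ℝ u x (Pi.single i 1) * w x ∂μ := by
    rw [← integral_sub ((gx i).mul (gu.mul gw)).integrable g2.integrable]
    congr 1; ext x; ring
  have E2 : ∫ x, u x * fderiv ℝ w x (Pi.single i 1) ∂μ
      = a * ∫ x, u x * v x ∂μ + ∫ x, x j / lam j * (u x * fderiv ℝ v x (Pi.single i 1)) ∂μ
        - ∫ x, u x * fderiv ℝ (fun y => fderiv ℝ v y (Pi.single i 1)) x (Pi.single j 1) ∂μ := by
    rw [← integral_const_mul, ← integral_add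
      ((gu.mul (hv.good lam)).const_mul a).integrable
      ((gx j).mul (gu.mul ((Dv i).good lam))).integrable, ← integral_sub
      (((gu.mul (hv.good lam)).const_mul a).add
      ((gx j).mul (gu.mul ((Dv i).good lam)))).integrable g3.integrable]
    congr 1; ext x
    rw [Dw, ou_symm hv]; ring
  change ∫ x, (x i / lam i * u x - fderiv ℝ u x (Pi.single i 1)) * w x ∂μ = _
  linarith

/-- Regularity estimate with the largest eigenvalue `λ₁` of `Q`: for `C = diag(c)`
positive semidefinite commuting with `Q = diag(λ)`,
`(1/λ₁)∫ ‖C Dφ‖² dμ + ∫ tr[(CD²φ)²] dμ ≤ ∫ (N₀φ)² dμ` for `φ ∈ C_b^∞(ℝⁿ)`. -/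
theorem OU_regularity_estimate_largest_eigenvalue
    {n : ℕ} (lam : Fin n → NNReal) (hlam : ∀ i, 0 < lam i)
    (lam1 : ℝ) (hlam1 : ∃ i, (lam i : ℝ) = lam1) (hmax : ∀ i, (lam i : ℝ) ≤ lam1)
    (c : Fin n → ℝ) (hc : ∀ i, 0 ≤ c i)
    (φ : (Fin n → ℝ) → ℝ) (hφ : IsCbSmooth φ) :
    (1 / lam1) * (∫ x, (∑ i, (((Matrix.diagonal c).mulVec (gradVec φ x)) i) ^ 2)
          ∂(Measure.pi fun j => gaussianReal 0 (lam j)))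
      + (∫ x, (∑ i, ∑ j, (∑ k, Matrix.diagonal c i k * hessMat φ x k j)
              * (∑ k, Matrix.diagonal c j k * hessMat φ x k i))
          ∂(Measure.pi fun j => gaussianReal 0 (lam j)))
      ≤ ∫ x, (OUop (Matrix.diagonal c) (fun i => (lam i : ℝ)) φ x) ^ 2
          ∂(Measure.pi fun j => gaussianReal 0 (lam j)) := by
  set μ := Measure.pi fun j => gaussianReal 0 (lam j) with hμ
  have Du := fun k : Fin n => hφ.pderiv (Pi.single k 1)
  have DDu := fun k l : Fin n => (Du k).pderiv (Pi.single l 1)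
  have gx := fun k : Fin n => (OUGood.coord lam k).div_const (lam k)
  set T : Fin n → (Fin n → ℝ) → ℝ := fun i x => x i / lam i * fderiv ℝ φ x (Pi.single i 1)
    - fderiv ℝ (fun y => fderiv ℝ φ y (Pi.single i 1)) x (Pi.single i 1) with hT
  have gT : ∀ i, OUGood lam (T i) := fun i =>
    ((gx i).mul ((Du i).good lam)).sub ((DDu i i).good lam)
  have hOU : ∀ x, (OUop (Matrix.diagonal c) (fun i => (lam i : ℝ)) φ x) ^ 2
      = ∑ i, ∑ j, c i * c j * (T i x * T j x) := by
    intro x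
    have : OUop (Matrix.diagonal c) (fun i => (lam i : ℝ)) φ x = - ∑ i, c i * T i x := by
      simp only [OUop, Matrix.diagonal_apply, ite_mul, zero_mul, Finset.sum_ite_eq,
        Finset.mem_univ, if_true, Matrix.mulVec_diagonal, hessMat, gradVec, hT]
      rw [← Finset.sum_sub_distrib, ← Finset.sum_neg_distrib]
      refine Finset.sum_congr rfl fun i _ => ?_
      ring
    rw [this, neg_sq, sq, Finset.sum_mul_sum]
    refine Finset.sum_congr rfl fun i _ => Finset.sum_congr rfl fun j _ => ?_
    ring
  have hR : ∫ x, (OUop (Matrix.diagonal c) (fun i => (lam i : ℝ)) φ x) ^ 2 ∂μ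
      = ∑ i, ∑ j, c i * c j * ∫ x, T i x * T j x ∂μ := by
    simp only [hOU]
    rw [integral_finsetSum _ fun i _ => integrable_finsetSum _ fun j _ =>
      (((gT i).mul (gT j)).const_mul (c i * c j)).integrable]
    refine Finset.sum_congr rfl fun i _ => ?_
    rw [integral_finsetSum _ fun j _ => (((gT i).mul (gT j)).const_mul (c i * c j)).integrable]
    refine Finset.sum_congr rfl fun j _ => ?_
    rw [integral_const_mul]
  have hG : ∫ x, (∑ i, (((Matrix.diagonal c).mulVec (gradVec φ x)) i) ^ 2) ∂μ
      = ∑ i, c i ^ 2 * ∫ x, fderiv ℝ φ x (Pi.single i 1) * fderiv ℝ φ x (Pi.single i 1) ∂μ := by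
    simp only [Matrix.mulVec_diagonal, gradVec, mul_pow]
    simp only [sq (fderiv ℝ φ _ _)]
    rw [integral_finsetSum _ fun i _ =>
      ((((Du i).good lam).mul ((Du i).good lam)).const_mul (c i ^ 2)).integrable]
    refine Finset.sum_congr rfl fun i _ => ?_
    rw [integral_const_mul]
  have hH : ∫ x, (∑ i, ∑ j, (∑ k, Matrix.diagonal c i k * hessMat φ x k j)
              * (∑ k, Matrix.diagonal c j k * hessMat φ x k i)) ∂μ
      = ∑ i, ∑ j, c i * c j * ∫ x,
        fderiv ℝ (fun y => fderiv ℝ φ y (Pi.single i 1)) x (Pi.single j 1) *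
        fderiv ℝ (fun y => fderiv ℝ φ y (Pi.single j 1)) x (Pi.single i 1) ∂μ := by
    have e : ∀ x, (∑ i, ∑ j, (∑ k, Matrix.diagonal c i k * hessMat φ x k j)
              * (∑ k, Matrix.diagonal c j k * hessMat φ x k i))
        = ∑ i, ∑ j, c i * c j * (
        fderiv ℝ (fun y => fderiv ℝ φ y (Pi.single i 1)) x (Pi.single j 1) *
        fderiv ℝ (fun y => fderiv ℝ φ y (Pi.single j 1)) x (Pi.single i 1)) := by
      intro x
      simp only [Matrix.diagonal_apply, ite_mul, zero_mul, Finset.sum_ite_eq,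
        Finset.mem_univ, if_true, hessMat]
      refine Finset.sum_congr rfl fun i _ => Finset.sum_congr rfl fun j _ => ?_
      ring
    have g : ∀ i j, OUGood lam (fun x => c i * c j * (
        fderiv ℝ (fun y => fderiv ℝ φ y (Pi.single i 1)) x (Pi.single j 1) *
        fderiv ℝ (fun y => fderiv ℝ φ y (Pi.single j 1)) x (Pi.single i 1))) := fun i j =>
      (((DDu i j).good lam).mul ((DDu j i).good lam)).const_mul _
    simp only [e]
    rw [integral_finsetSum _ fun i _ => integrable_finsetSum _ fun j _ => (g i j).integrable]
    refine Finset.sum_congr rfl fun i _ => ?_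
    rw [integral_finsetSum _ fun j _ => (g i j).integrable]
    refine Finset.sum_congr rfl fun j _ => ?_
    rw [integral_const_mul]
  have hK := fun i j => ou_key lam hlam i j (Du i) (Du j)
  rw [hR, hG, hH]
  have hR2 : ∑ i, ∑ j, c i * c j * ∫ x, T i x * T j x ∂μ
      = ∑ i, (1 / (lam i : ℝ)) * (c i ^ 2 *
          ∫ x, fderiv ℝ φ x (Pi.single i 1) * fderiv ℝ φ x (Pi.single i 1) ∂μ)
        + ∑ i, ∑ j, c i * c j * ∫ x,
        fderiv ℝ (fun y => fderiv ℝ φ y (Pi.single i 1)) x (Pi.single j 1) *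
        fderiv ℝ (fun y => fderiv ℝ φ y (Pi.single j 1)) x (Pi.single i 1) ∂μ := by
    rw [← Finset.sum_add_distrib]
    refine Finset.sum_congr rfl fun i _ => ?_
    simp only [hT, hμ, hK, mul_add, Finset.sum_add_distrib, ite_mul, mul_ite, zero_mul, mul_zero,
      Finset.sum_ite_eq, Finset.mem_univ, if_true]
    ring
  rw [hR2]
  refine add_le_add_left ?_ _
  rw [Finset.mul_sum]
  refine Finset.sum_le_sum fun i _ => ?_
  refine mul_le_mul_of_nonneg_right ?_ (mul_nonneg (sq_nonneg _)
    (integral_nonneg fun x => mul_self_nonneg _))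
  exact one_div_le_one_div_of_le (by exact_mod_cast hlam i) (hmax i)
end

section
/- Let μ = μ₁ ⊗ μ₂ be the product of centered nondegenerate Gaussian measures on ℝⁿ × ℝⁿ with diagonal covariances Q₁ = diag(λ₁,...,λₙ) and Q₂ = diag(ν₁,...,νₙ). Let K₂₂ be symmetric positive definite, K₁₂ any n×n matrix, K₂₁ = K₁₂ᵀ, all diagonal-invariant. Define for φ ∈ C_b^∞(ℝⁿ×ℝⁿ): Lφ = tr[K₂₂ D₂²φ] - ⟨y, Q₂⁻¹K₂₂D₂φ⟩ - ⟨x, Q₁⁻¹K₂₁D₂φ⟩ + ⟨y, Q₂⁻¹K₁₂D₁φ⟩. Then ∫ Lφ dμ = 0 for all φ ∈ C_b^∞(ℝⁿ×ℝⁿ), i.e. μ is infinitesimally invariant for L. -/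
open MeasureTheory ProbabilityTheory

/-- Gradient in the first (spatial) variable. -/
noncomputable def d1 {n : ℕ} (φ : (Fin n → ℝ) × (Fin n → ℝ) → ℝ)
    (p : (Fin n → ℝ) × (Fin n → ℝ)) : Fin n → ℝ :=
  fun i => fderiv ℝ φ p (Pi.single i 1, 0)

/-- Gradient in the second (velocity) variable. -/
noncomputable def d2 {n : ℕ} (φ : (Fin n → ℝ) × (Fin n → ℝ) → ℝ)
    (p : (Fin n → ℝ) × (Fin n → ℝ)) : Fin n → ℝ :=
  fun i => fderiv ℝ φ p (0, Pi.single i 1)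

/-- Hessian in the second (velocity) variable, as a matrix. -/
noncomputable def hess2 {n : ℕ} (φ : (Fin n → ℝ) × (Fin n → ℝ) → ℝ)
    (p : (Fin n → ℝ) × (Fin n → ℝ)) : Matrix (Fin n) (Fin n) ℝ :=
  fun i j => fderiv ℝ (fun q => fderiv ℝ φ q (0, Pi.single j 1)) p (0, Pi.single i 1)

/-- The finite-dimensional Langevin operator
`Lφ = tr[K₂₂ D₂²φ] - ⟨y, Q₂⁻¹K₂₂D₂φ⟩ - ⟨x, Q₁⁻¹K₂₁D₂φ⟩ + ⟨y, Q₂⁻¹K₁₂D₁φ⟩`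
with `Q₁ = diag(lam)`, `Q₂ = diag(nu)` and `K₂₁ = K₁₂ᵀ`. -/
noncomputable def Lop {n : ℕ} (K22 K12 : Matrix (Fin n) (Fin n) ℝ)
    (lam nu : Fin n → ℝ) (φ : (Fin n → ℝ) × (Fin n → ℝ) → ℝ)
    (p : (Fin n → ℝ) × (Fin n → ℝ)) : ℝ :=
  (∑ i, ∑ j, K22 i j * hess2 φ p j i)
    - (∑ i, p.2 i * (1 / nu i) * (K22.mulVec (d2 φ p)) i)
    - (∑ i, p.1 i * (1 / lam i) * ((K12.transpose).mulVec (d2 φ p)) i)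
    + ∑ i, p.2 i * (1 / nu i) * (K12.mulVec (d1 φ p)) i

/-- The product Gaussian measure `μ = N(0, diag(lam)) ⊗ N(0, diag(nu))` on ℝⁿ × ℝⁿ. -/
noncomputable def gaussProd {n : ℕ} (lam nu : Fin n → NNReal) :
    Measure ((Fin n → ℝ) × (Fin n → ℝ)) :=
  (Measure.pi fun j => gaussianReal 0 (lam j)).prod
    (Measure.pi fun j => gaussianReal 0 (nu j))

lemma cb_dir {E : Type*} [NormedAddCommGroup E] [NormedSpace ℝ E] {φ : E → ℝ}
    (h : IsCbSmooth φ) (v : E) : IsCbSmooth (fun q => fderiv ℝ φ q v) := by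
  have hs : ContDiff ℝ (⊤ : ℕ∞) (fderiv ℝ φ) := h.1.fderiv_right (by simp)
  refine ⟨hs.clm_apply contDiff_const, fun k => ?_⟩
  obtain ⟨C, hC⟩ := h.2 (k + 1)
  refine ⟨‖v‖ * C, fun x => ?_⟩
  refine (norm_iteratedFDeriv_clm_apply_const (n := k) hs.contDiffAt (by exact_mod_cast le_top)).trans ?_
  rw [norm_iteratedFDeriv_fderiv]
  exact mul_le_mul_of_nonneg_left (hC x) (norm_nonneg _)

lemma cb_bdd {E : Type*} [NormedAddCommGroup E] [NormedSpace ℝ E] {φ : E → ℝ}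
    (h : IsCbSmooth φ) : ∃ C, ∀ x, ‖φ x‖ ≤ C := by
  obtain ⟨C, hC⟩ := h.2 0
  exact ⟨C, fun x => by simpa using hC x⟩

lemma cb_cont {E : Type*} [NormedAddCommGroup E] [NormedSpace ℝ E] {φ : E → ℝ}
    (h : IsCbSmooth φ) : Continuous φ := h.1.continuous

lemma cb_diff {E : Type*} [NormedAddCommGroup E] [NormedSpace ℝ E] {φ : E → ℝ}
    (h : IsCbSmooth φ) : Differentiable ℝ φ := h.1.differentiable (by simp)

lemma integrable_bdd {E : Type*} [TopologicalSpace E] [MeasurableSpace E]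
    [OpensMeasurableSpace E] {μ : Measure E} [IsFiniteMeasure μ] {f : E → ℝ}
    (hf : Continuous f) (hb : ∃ C, ∀ x, ‖f x‖ ≤ C) : Integrable f μ := by
  obtain ⟨C, hC⟩ := hb
  exact Integrable.of_bound hf.measurable.aestronglyMeasurable C (ae_of_all _ hC)

lemma integrable_mul_bdd {E : Type*} [TopologicalSpace E] [MeasurableSpace E]
    [OpensMeasurableSpace E] {μ : Measure E} {f g : E → ℝ} (hg : Integrable g μ)
    (hf : Continuous f) (hb : ∃ C, ∀ x, ‖f x‖ ≤ C) : Integrable (fun x => g x * f x) μ := by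
  obtain ⟨C, hC⟩ := hb
  exact hg.mul_bdd (c := C) hf.measurable.aestronglyMeasurable (ae_of_all _ hC)

lemma integrable_id_gauss (v : NNReal) : Integrable (fun t : ℝ => t) (gaussianReal 0 v) :=
  memLp_one_iff_integrable.1 (memLp_id_gaussianReal' 1 (by simp))

lemma hasDerivAt_pdf {v : NNReal} (hv : 0 < v) (t : ℝ) :
    HasDerivAt (gaussianPDFReal 0 v) (-(t / v) * gaussianPDFReal 0 v t) t := by
  have hv' : (v : ℝ) ≠ 0 := by exact_mod_cast hv.ne'
  rw [gaussianPDFReal_def]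
  have h1 : HasDerivAt (fun x : ℝ => -(x - 0) ^ 2 / (2 * v)) (-(t / v)) t := by
    have h0 := (((((hasDerivAt_id t).sub_const 0).pow 2).neg).div_const (2 * (v : ℝ)))
    refine (h0.congr_deriv ?_).congr_of_eventuallyEq (Filter.Eventually.of_forall fun x => ?_)
    · simp only [id]
      push_cast
      field_simp
      ring
    · simp
  refine (h1.exp.const_mul ((√(2 * Real.pi * v))⁻¹)).congr_deriv ?_
  ring

lemma integrable_pdf_mul {v : NNReal} (hv : 0 < v) {f : ℝ → ℝ}
    (hf : Integrable f (gaussianReal 0 v)) :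
    Integrable (fun t => gaussianPDFReal 0 v t * f t) := by
  rw [gaussianReal_of_var_ne_zero 0 hv.ne', integrable_withDensity_iff_integrable_smul'
    (measurable_gaussianPDF _ _) (ae_of_all _ fun _ => gaussianPDF_lt_top)] at hf
  simpa using hf

lemma stein_one {v : NNReal} (hv : 0 < v) {f g : ℝ → ℝ} (hd : ∀ t, HasDerivAt f (g t) t)
    (hg : Continuous g) (hfb : ∃ C, ∀ x, ‖f x‖ ≤ C) (hgb : ∃ C, ∀ x, ‖g x‖ ≤ C) :
    ∫ t, t * f t ∂(gaussianReal 0 v) = v * ∫ t, g t ∂(gaussianReal 0 v) := by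
  have hv' : (v : ℝ) ≠ 0 := by exact_mod_cast hv.ne'
  have hf : Continuous f := continuous_iff_continuousAt.2 fun t => (hd t).continuousAt
  have i1 := integrable_pdf_mul hv (integrable_mul_bdd (integrable_id_gauss v) hf hfb)
  have i2 := integrable_pdf_mul hv (integrable_bdd (μ := gaussianReal 0 v) hg hgb)
  have i3 := integrable_pdf_mul hv (integrable_bdd (μ := gaussianReal 0 v) hf hfb)
  have key := integral_mul_deriv_eq_deriv_mul_of_integrable (u := f) (u' := g)
    (v := gaussianPDFReal 0 v) (v' := fun t => -(t / v) * gaussianPDFReal 0 v t)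
    (fun t _ => hd t) (fun t _ => hasDerivAt_pdf hv t)
    (by
      convert i1.const_mul (-(v : ℝ)⁻¹) using 1
      ext t; simp; ring)
    (by convert i2 using 1; ext t; simp; ring)
    (by convert i3 using 1; ext t; simp; ring)
  rw [integral_gaussianReal_eq_integral_smul hv.ne', integral_gaussianReal_eq_integral_smul hv.ne']
  have e1 : ∫ t, f t * (-(t / v) * gaussianPDFReal 0 v t)
      = -(v : ℝ)⁻¹ * ∫ t, gaussianPDFReal 0 v t • (t * f t) := by
    rw [← integral_const_mul]; congr 1; ext t; simp; ring
  have e2 : ∫ t, g t * gaussianPDFReal 0 v t = ∫ t, gaussianPDFReal 0 v t • g t := by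
    congr 1; ext t; simp; ring
  rw [e1, e2] at key
  field_simp at key
  linarith

lemma integrable_coord {n : ℕ} (v : Fin n → NNReal) (i : Fin n) :
    Integrable (fun x : Fin n → ℝ => x i) (Measure.pi fun j => gaussianReal 0 (v j)) :=
  (measurePreserving_eval (fun j => gaussianReal 0 (v j)) i).integrable_comp_of_integrable
    (integrable_id_gauss (v i))

lemma stein_pi {n : ℕ} (v : Fin n → NNReal) (hv : ∀ i, 0 < v i) (i : Fin n)
    {f g : (Fin n → ℝ) → ℝ} (hf : Continuous f) (hg : Continuous g)
    (hd : ∀ x t, HasDerivAt (fun s => f (Function.update x i s)) (g (Function.update x i t)) t)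
    (hfb : ∃ C, ∀ x, ‖f x‖ ≤ C) (hgb : ∃ C, ∀ x, ‖g x‖ ≤ C) :
    ∫ x, x i * f x ∂(Measure.pi fun j => gaussianReal 0 (v j))
      = v i * ∫ x, g x ∂(Measure.pi fun j => gaussianReal 0 (v j)) := by
  cases n with
  | zero => exact i.elim0
  | succ m =>
    have mp := (measurePreserving_piFinSuccAbove (fun j => gaussianReal 0 (v j)) i).symm
    have I1 : Integrable (fun x : Fin (m + 1) → ℝ => x i * f x)
        (Measure.pi fun j => gaussianReal 0 (v j)) :=
      integrable_mul_bdd (integrable_coord v i) hf hfb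
    have I2 : Integrable g (Measure.pi fun j => gaussianReal 0 (v j)) := integrable_bdd hg hgb
    rw [← mp.integral_comp', ← mp.integral_comp']
    have J1 := mp.integrable_comp_of_integrable I1
    have J2 := mp.integrable_comp_of_integrable I2
    simp only [Function.comp_def] at J1 J2
    rw [integral_prod_symm _ J1, integral_prod_symm _ J2, ← integral_const_mul]
    congr 1; ext z
    simp only [MeasurableEquiv.piFinSuccAbove_symm_apply, Fin.insertNthEquiv_apply,
      Fin.insertNth_apply_same]
    have hu : ∀ s : ℝ, Function.update (i.insertNth (0 : ℝ) z : Fin (m + 1) → ℝ) i s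
        = (i.insertNth s z : Fin (m + 1) → ℝ) := by
      intro s; simp
    refine stein_one (hv i) (f := fun t => f (i.insertNth t z : Fin (m + 1) → ℝ))
      (g := fun t => g (i.insertNth t z : Fin (m + 1) → ℝ)) (fun t => ?_) ?_ ?_ ?_
    · have h1 := hd (i.insertNth (0 : ℝ) z : Fin (m + 1) → ℝ) t
      simp only [hu] at h1
      exact h1
    · have h1 := hg.comp ((continuous_const (y := (i.insertNth (0 : ℝ) z :
        Fin (m + 1) → ℝ))).update i (continuous_id (X := ℝ)))
      simp only [Function.comp_def, id, hu] at h1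
      exact h1
    · exact hfb.imp fun C h x => h _
    · exact hgb.imp fun C h x => h _

section
variable {n : ℕ} (lam nu : Fin n → NNReal)

instance : IsProbabilityMeasure (gaussProd lam nu) := by
  unfold gaussProd; infer_instance

lemma int_x (i : Fin n) : Integrable (fun p => p.1 i) (gaussProd lam nu) :=
  (integrable_coord lam i).comp_fst _

lemma int_y (i : Fin n) : Integrable (fun p => p.2 i) (gaussProd lam nu) :=
  (integrable_coord nu i).comp_snd _

lemma stein_x (hlam : ∀ i, 0 < lam i) (i : Fin n)
    {φ : (Fin n → ℝ) × (Fin n → ℝ) → ℝ} (h : IsCbSmooth φ) :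
    ∫ p, p.1 i * φ p ∂(gaussProd lam nu)
      = lam i * ∫ p, fderiv ℝ φ p (Pi.single i 1, 0) ∂(gaussProd lam nu) := by
  have h' := cb_dir h (Pi.single i 1, 0)
  have I1 := integrable_mul_bdd (int_x lam nu i) (cb_cont h) (cb_bdd h)
  have I2 := integrable_bdd (μ := gaussProd lam nu) (cb_cont h') (cb_bdd h')
  unfold gaussProd at *
  rw [integral_prod_symm _ I1, integral_prod_symm _ I2, ← integral_const_mul]
  congr 1; ext y
  refine stein_pi lam hlam i (f := fun x => φ (x, y)) ((cb_cont h).comp (by fun_prop))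
    ((cb_cont h').comp (by fun_prop)) (fun x t => ?_)
    ((cb_bdd h).imp fun C hC x => hC _) ((cb_bdd h').imp fun C hC x => hC _)
  exact (cb_diff h _).hasFDerivAt.comp_hasDerivAt t
    ((hasDerivAt_update x i t).prodMk (hasDerivAt_const t y))

lemma stein_y (hnu : ∀ i, 0 < nu i) (i : Fin n)
    {φ : (Fin n → ℝ) × (Fin n → ℝ) → ℝ} (h : IsCbSmooth φ) :
    ∫ p, p.2 i * φ p ∂(gaussProd lam nu)
      = nu i * ∫ p, fderiv ℝ φ p (0, Pi.single i 1) ∂(gaussProd lam nu) := by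
  have h' := cb_dir h (0, Pi.single i 1)
  have I1 := integrable_mul_bdd (int_y lam nu i) (cb_cont h) (cb_bdd h)
  have I2 := integrable_bdd (μ := gaussProd lam nu) (cb_cont h') (cb_bdd h')
  unfold gaussProd at *
  rw [integral_prod _ I1, integral_prod _ I2, ← integral_const_mul]
  congr 1; ext x
  refine stein_pi nu hnu i (f := fun y => φ (x, y)) ((cb_cont h).comp (by fun_prop))
    ((cb_cont h').comp (by fun_prop)) (fun y t => ?_)
    ((cb_bdd h).imp fun C hC x => hC _) ((cb_bdd h').imp fun C hC x => hC _)
  exact (cb_diff h _).hasFDerivAt.comp_hasDerivAt t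
    ((hasDerivAt_const t x).prodMk (hasDerivAt_update y i t))

end

lemma dir_symm {E : Type*} [NormedAddCommGroup E] [NormedSpace ℝ E] {φ : E → ℝ}
    (h : IsCbSmooth φ) (v w p : E) :
    fderiv ℝ (fun q => fderiv ℝ φ q v) p w = fderiv ℝ (fun q => fderiv ℝ φ q w) p v := by
  have hs : Differentiable ℝ (fderiv ℝ φ) :=
    (h.1.fderiv_right (m := (⊤ : ℕ∞)) (by simp)).differentiable (by simp)
  have hsym : IsSymmSndFDerivAt ℝ φ p :=
    h.1.contDiffAt.isSymmSndFDerivAt (by simp; exact WithTop.coe_le_coe.2 (le_top : (2 : ℕ∞) ≤ ⊤))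
  have e : ∀ v w : E, fderiv ℝ (fun q => fderiv ℝ φ q v) p w = fderiv ℝ (fderiv ℝ φ) p w v := by
    intro v w
    rw [fderiv_clm_apply (hs p) (differentiableAt_const v)]
    simp
  rw [e, e]
  exact hsym w v

/-- Infinitesimal invariance of `μ` for the finite-dimensional Langevin operator:
`∫ Lφ dμ = 0` for all `φ ∈ C_b^∞(ℝⁿ×ℝⁿ)`. -/
theorem langevin_infinitesimally_invariant
    {n : ℕ} (lam nu : Fin n → NNReal) (hlam : ∀ i, 0 < lam i) (hnu : ∀ i, 0 < nu i)
    (K22 K12 : Matrix (Fin n) (Fin n) ℝ) (hK22symm : K22.IsSymm) (hK22 : K22.PosDef)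
    (φ : (Fin n → ℝ) × (Fin n → ℝ) → ℝ) (hφ : IsCbSmooth φ) :
    ∫ p, Lop K22 K12 (fun i => (lam i : ℝ)) (fun i => (nu i : ℝ)) φ p
        ∂(gaussProd lam nu) = 0 := by
  set μ := gaussProd lam nu with hμ
  have hx := fun i => cb_dir hφ (Pi.single i 1, 0)
  have hy := fun i => cb_dir hφ (0, Pi.single i 1)
  -- integrability of the individual terms
  have IA : ∀ i j, Integrable (fun p => K22 i j * hess2 φ p j i) μ := fun i j =>
    (integrable_bdd (cb_cont (cb_dir (hy i) (0, Pi.single j 1)))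
      (cb_bdd (cb_dir (hy i) (0, Pi.single j 1)))).const_mul _
  have IB : ∀ i j, Integrable (fun p => K22 i j * (1 / nu i) * (p.2 i * d2 φ p j)) μ := fun i j =>
    (integrable_mul_bdd (int_y lam nu i) (cb_cont (hy j)) (cb_bdd (hy j))).const_mul _
  have IC : ∀ i j, Integrable (fun p => K12 j i * (1 / lam i) * (p.1 i * d2 φ p j)) μ := fun i j =>
    (integrable_mul_bdd (int_x lam nu i) (cb_cont (hy j)) (cb_bdd (hy j))).const_mul _
  have ID : ∀ i j, Integrable (fun p => K12 i j * (1 / nu i) * (p.2 i * d1 φ p j)) μ := fun i j =>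
    (integrable_mul_bdd (int_y lam nu i) (cb_cont (hx j)) (cb_bdd (hx j))).const_mul _
  have eq : ∀ p, Lop K22 K12 (fun i => (lam i : ℝ)) (fun i => (nu i : ℝ)) φ p =
      (∑ i, ∑ j, K22 i j * hess2 φ p j i)
      - (∑ i, ∑ j, K22 i j * (1 / nu i) * (p.2 i * d2 φ p j))
      - (∑ i, ∑ j, K12 j i * (1 / lam i) * (p.1 i * d2 φ p j))
      + ∑ i, ∑ j, K12 i j * (1 / nu i) * (p.2 i * d1 φ p j) := by
    intro p
    simp only [Lop, Matrix.mulVec, dotProduct, Matrix.transpose_apply, Finset.mul_sum]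
    congr 1
    · congr 1
      · congr 1
        refine Finset.sum_congr rfl fun i _ => Finset.sum_congr rfl fun j _ => by ring
      · refine Finset.sum_congr rfl fun i _ => Finset.sum_congr rfl fun j _ => by ring
    · refine Finset.sum_congr rfl fun i _ => Finset.sum_congr rfl fun j _ => by ring
  have SA := integrable_finsetSum Finset.univ fun i _ =>
    integrable_finsetSum Finset.univ fun j _ => IA i j
  have SB := integrable_finsetSum Finset.univ fun i _ =>
    integrable_finsetSum Finset.univ fun j _ => IB i j
  have SC := integrable_finsetSum Finset.univ fun i _ =>
    integrable_finsetSum Finset.univ fun j _ => IC i j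
  have SD := integrable_finsetSum Finset.univ fun i _ =>
    integrable_finsetSum Finset.univ fun j _ => ID i j
  simp_rw [eq]
  have lin : ∀ a b c d : ((Fin n → ℝ) × (Fin n → ℝ)) → ℝ, Integrable a μ → Integrable b μ →
      Integrable c μ → Integrable d μ → ∫ p, (a p - b p - c p + d p) ∂μ
        = ∫ p, a p ∂μ - ∫ p, b p ∂μ - ∫ p, c p ∂μ + ∫ p, d p ∂μ := by
    intro a b c d ha hb hc hd
    have h1 : Integrable (fun p => a p - b p) μ := ha.sub hb
    have h2 : Integrable (fun p => a p - b p - c p) μ := h1.sub hc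
    rw [integral_add h2 hd, integral_sub h1 hc, integral_sub ha hb]
  rw [lin _ _ _ _ SA SB SC SD]
  have push : ∀ F : Fin n → Fin n → ((Fin n → ℝ) × (Fin n → ℝ)) → ℝ,
      (∀ i j, Integrable (F i j) μ) →
      ∫ p, ∑ i, ∑ j, F i j p ∂μ = ∑ i, ∑ j, ∫ p, F i j p ∂μ := by
    intro F hF
    rw [integral_finsetSum _ fun i _ => integrable_finsetSum _ fun j _ => hF i j]
    exact Finset.sum_congr rfl fun i _ => integral_finsetSum _ fun j _ => hF i j
  rw [push _ IA, push _ IB, push _ IC, push _ ID]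
  have hl : ∀ i, (lam i : ℝ) ≠ 0 := fun i => by exact_mod_cast (hlam i).ne'
  have hn : ∀ i, (nu i : ℝ) ≠ 0 := fun i => by exact_mod_cast (hnu i).ne'
  have E1 : ∑ i, ∑ j, ∫ p, K22 i j * hess2 φ p j i ∂μ
      = ∑ i, ∑ j, ∫ p, K22 i j * (1 / nu i) * (p.2 i * d2 φ p j) ∂μ := by
    refine Finset.sum_congr rfl fun i _ => Finset.sum_congr rfl fun j _ => ?_
    rw [integral_const_mul, integral_const_mul]
    have := stein_y lam nu hnu i (hy j)
    simp only [d2, hess2]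
    rw [this]
    simp_rw [dir_symm hφ (0, Pi.single i 1) (0, Pi.single j 1)]
    have := hn i
    rw [← hμ]
    field_simp
  have E2 : ∑ i, ∑ j, ∫ p, K12 j i * (1 / lam i) * (p.1 i * d2 φ p j) ∂μ
      = ∑ i, ∑ j, ∫ p, K12 i j * (1 / nu i) * (p.2 i * d1 φ p j) ∂μ := by
    rw [Finset.sum_comm]
    refine Finset.sum_congr rfl fun i _ => Finset.sum_congr rfl fun j _ => ?_
    rw [integral_const_mul, integral_const_mul]
    simp only [d2, d1]
    rw [stein_y lam nu hnu i (hx j), stein_x lam nu hlam j (hy i)]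
    simp_rw [dir_symm hφ (0, Pi.single i 1) (Pi.single j 1, 0)]
    have := hn i
    have := hl j
    field_simp
  rw [E1, E2]
  ring
end
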